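/- Let v_1,...,v_m ∈ ℝ^d and let μ be a homogeneous strongly Rayleigh probability distribution on subsets of [m]. Then the mixed characteristic polynomial μ[v_1,...,v_m](x) = Σ_{S⊆[m]} μ(S) · det(x²·I − Σ_{i∈S} 2·v_i v_iᵀ) is real-rooted: every complex root of this univariate polynomial is real. -/

import Mathlib

noncomputable section

/-- A polynomial `p ∈ ℝ[z_1,...,z_m]` is real stable if it has no root
`(z_1,...,z_m) ∈ ℂ^m` with `Im(z_i) > 0` for every `i`. -/
def RealStable {m : ℕ} (p : MvPolynomial (Fin m) ℝ) : Prop :=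
  ∀ z : Fin m → ℂ, (∀ i, 0 < (z i).im) → (MvPolynomial.aeval z) p ≠ 0

/-- The generating polynomial of a distribution on subsets of `[m]`. -/
def genPoly {m : ℕ} (μ : Finset (Fin m) → ℝ) : MvPolynomial (Fin m) ℝ :=
  ∑ S : Finset (Fin m), MvPolynomial.C (μ S) * ∏ i ∈ S, MvPolynomial.X i

/-- The mixed characteristic polynomial
`μ[v_1,...,v_m](x) = Σ_S μ(S)·det(x²·I − Σ_{i∈S} 2 v_i v_iᵀ)`. -/
def mixedCharPoly {m d : ℕ} (μ : Finset (Fin m) → ℝ) (v : Fin m → Fin d → ℝ) :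
    Polynomial ℝ :=
  ∑ S : Finset (Fin m), Polynomial.C (μ S) *
    ((Polynomial.X ^ 2 : Polynomial ℝ) • (1 : Matrix (Fin d) (Fin d) (Polynomial ℝ)) -
      (∑ i ∈ S, (2 : ℝ) • Matrix.vecMulVec (v i) (v i)).map
        (fun a => Polynomial.C a)).det

/-- The elementary two-variable step. -/
lemma aux_two (α β γ δ : ℂ)
    (h : ∀ z w : ℂ, 0 ≤ z.im → 0 ≤ w.im → α + β * z + γ * w + δ * (z * w) ≠ 0) :
    α - δ ≠ 0 := by
  intro hd
  have hαδ : δ = α := (sub_eq_zero.mp hd).symm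
  subst hαδ
  have hα : δ ≠ 0 := by simpa using h 0 0 (by simp) (by simp)
  have inv_im : ∀ z : ℂ, 0 ≤ z.im → 0 ≤ (-z⁻¹).im := by
    intro z hz
    rw [Complex.neg_im, Complex.inv_im, neg_div, neg_neg]
    exact div_nonneg hz (Complex.normSq_nonneg z)
  have key : ∀ β : ℂ, ∃ w : ℂ, 0 < w.im ∧ 0 < (β / δ + w).im := by
    intro β
    refine ⟨⟨0, |(β / δ).im| + 1⟩, ?_, ?_⟩
    · show 0 < |(β / δ).im| + 1
      positivity
    · rw [Complex.add_im]
      show 0 < (β / δ).im + (|(β / δ).im| + 1)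
      have := neg_abs_le (β / δ).im
      linarith
  by_cases hγ : γ = 0
  · subst hγ
    obtain ⟨w, hw, hw2⟩ := key β
    have hne : β / δ + w ≠ 0 := by
      intro h0; rw [h0] at hw2; simp at hw2
    refine h (-(β / δ + w)⁻¹) w (inv_im _ hw2.le) hw.le ?_
    have hne' : β + δ * w ≠ 0 := by
      intro h0; apply hne; field_simp; linear_combination h0
    field_simp
    ring
  by_cases hβ : β = 0
  · subst hβ
    obtain ⟨w, hw, hw2⟩ := key γ
    have hne : γ / δ + w ≠ 0 := by
      intro h0; rw [h0] at hw2; simp at hw2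
    refine h w (-(γ / δ + w)⁻¹) hw.le (inv_im _ hw2.le) ?_
    have hne' : γ + δ * w ≠ 0 := by
      intro h0; apply hne; field_simp; linear_combination h0
    field_simp
    ring
  obtain ⟨s, hs⟩ := IsAlgClosed.exists_pow_nat_eq (γ / β) (n := 2) (by norm_num)
  have hex : ∃ s : ℂ, s ^ 2 = γ / β ∧ 0 ≤ s.im := by
    rcases le_total 0 s.im with h0 | h0
    · exact ⟨s, hs, h0⟩
    · exact ⟨-s, by rw [neg_sq, hs], by simpa using h0⟩
  obtain ⟨z, hz, hz0⟩ := hex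
  have hzne : z ≠ 0 := by
    rintro rfl
    have : γ / β ≠ 0 := div_ne_zero hγ hβ
    apply this; rw [← hz]; simp
  refine h z (-z⁻¹) hz0 (inv_im z hz0) ?_
  have e : z ^ 2 * β = γ := by rw [hz]; field_simp
  rw [← e]
  field_simp
  ring

/-- Pairing of two multi-affine polynomials without zeros in closed upper half planes. -/
lemma aux_pair {ι : Type*} [DecidableEq ι] (s : Finset ι) : ∀ (a b : Finset ι → ℂ),
    (∀ z : ι → ℂ, (∀ i, 0 ≤ (z i).im) → ∑ T ∈ s.powerset, a T * ∏ i ∈ T, z i ≠ 0) →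
    (∀ z : ι → ℂ, (∀ i, 0 ≤ (z i).im) → ∑ T ∈ s.powerset, b T * ∏ i ∈ T, z i ≠ 0) →
    ∑ T ∈ s.powerset, (-1) ^ T.card * (a T * b T) ≠ 0 := by
  induction s using Finset.induction_on with
  | empty =>
    intro a b ha hb
    have h1 := ha 0 (by simp)
    have h2 := hb 0 (by simp)
    simp at h1 h2 ⊢
    exact ⟨h1, h2⟩
  | insert j s hj ih =>
    intro a b ha hb
    have red : ∀ a : Finset ι → ℂ,
        (∀ z : ι → ℂ, (∀ i, 0 ≤ (z i).im) →
          ∑ T ∈ (insert j s).powerset, a T * ∏ i ∈ T, z i ≠ 0) →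
        ∀ t : ℂ, 0 ≤ t.im → ∀ z : ι → ℂ, (∀ i, 0 ≤ (z i).im) →
          ∑ T ∈ s.powerset, (a T + t * a (insert j T)) * ∏ i ∈ T, z i ≠ 0 := by
      intro a ha t ht z hz
      have := ha (Function.update z j t) (by
        intro i
        by_cases hi : i = j
        · subst hi; simpa using ht
        · simpa [hi] using hz i)
      rw [Finset.sum_powerset_insert hj, ← Finset.sum_add_distrib] at this
      convert this using 1
      refine Finset.sum_congr rfl fun T hT => ?_
      have hjT : j ∉ T := fun h => hj (Finset.mem_powerset.mp hT h)
      rw [Finset.prod_insert hjT, Function.update_self]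
      have : ∏ i ∈ T, Function.update z j t i = ∏ i ∈ T, z i := by
        refine Finset.prod_congr rfl fun i hi => ?_
        rw [Function.update_of_ne]
        rintro rfl; exact hjT hi
      rw [this]; ring
    have main := aux_two
      (∑ T ∈ s.powerset, (-1) ^ T.card * (a T * b T))
      (∑ T ∈ s.powerset, (-1) ^ T.card * (a (insert j T) * b T))
      (∑ T ∈ s.powerset, (-1) ^ T.card * (a T * b (insert j T)))
      (∑ T ∈ s.powerset, (-1) ^ T.card * (a (insert j T) * b (insert j T)))
      (by
        intro z w hz hw
        have := ih (fun T => a T + z * a (insert j T)) (fun T => b T + w * b (insert j T))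
          (red a ha z hz) (red b hb w hw)
        convert this using 1
        simp only [Finset.sum_mul, ← Finset.sum_add_distrib]
        refine Finset.sum_congr rfl fun T _ => ?_
        ring)
    convert main using 1
    rw [Finset.sum_powerset_insert hj, sub_eq_add_neg, ← Finset.sum_neg_distrib]
    congr 1
    refine Finset.sum_congr rfl fun T hT => ?_
    have hjT : j ∉ T := fun h => hj (Finset.mem_powerset.mp hT h)
    rw [Finset.card_insert_of_notMem hjT, pow_succ]
    ring

/-- Multi-affine expansion of the determinant. -/
lemma aux_expand {m d : ℕ} (w : Fin m → Fin d → ℂ) : ∃ G : Finset (Fin m) → ℂ,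
    ∀ y : Fin m → ℂ, (1 + ∑ i, y i • Matrix.vecMulVec (w i) (w i)).det =
      ∑ T : Finset (Fin m), G T * ∏ i ∈ T, y i := by
  let W : Matrix (Fin m) (Fin d) ℂ := Matrix.of w
  let K : Fin m → Fin m → ℂ := W * W.transpose
  let I : Fin m → Fin m → ℂ := (1 : Matrix (Fin m) (Fin m) ℂ)
  refine ⟨fun T => Matrix.detRowAlternating (T.piecewise K I), ?_⟩
  intro y
  have h1 : (∑ i, y i • Matrix.vecMulVec (w i) (w i)) =
      W.transpose * (Matrix.diagonal y * W) := by
    ext a b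
    simp [W, Matrix.sum_apply, Matrix.mul_apply, Matrix.vecMulVec_apply,
      Matrix.diagonal_apply]
    refine Finset.sum_congr rfl fun i _ => ?_
    ring
  rw [h1, Matrix.det_one_add_mul_comm, Matrix.mul_assoc]
  have h2 : (1 + Matrix.diagonal y * (W * W.transpose)).det =
      Matrix.detRowAlternating.toMultilinearMap
        ((fun i => y i • K i) + I) := by
    rw [add_comm]
    show Matrix.det _ = Matrix.det _
    congr 1
    ext a b
    rw [Matrix.add_apply, Matrix.diagonal_mul]
    rfl
  rw [h2, MultilinearMap.map_add_univ]
  refine Finset.sum_congr rfl fun T _ => ?_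
  have := Matrix.detRowAlternating.toMultilinearMap.map_piecewise_smul (R := ℂ) y
    (T.piecewise K I) T
  have e : (T.piecewise (fun i => y i • K i) I) =
      T.piecewise (fun i => y i • (T.piecewise K I) i)
        (T.piecewise K I) := by
    funext i
    by_cases hi : i ∈ T <;> simp [hi]
  rw [e, this, smul_eq_mul, mul_comm]
  rfl

/-- Nonvanishing of the determinant. -/
lemma aux_det {m d : ℕ} (v : Fin m → Fin d → ℝ) (x : ℂ) (hx : 0 < x.im) (z : Fin m → ℂ)
    (hz : ∀ i, 0 ≤ (z i).im) :
    (x • (1 : Matrix (Fin d) (Fin d) ℂ) + ∑ i, z i • Matrix.vecMulVec (fun k => (v i k : ℂ))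
      (fun k => (v i k : ℂ))).det ≠ 0 := by
  intro h
  obtain ⟨u, hu, h0⟩ := Matrix.exists_mulVec_eq_zero_iff.mpr h
  have h1 : star u ⬝ᵥ ((x • (1 : Matrix (Fin d) (Fin d) ℂ) + ∑ i, z i •
      Matrix.vecMulVec (fun k => (v i k : ℂ)) (fun k => (v i k : ℂ))).mulVec u) = 0 := by
    rw [h0]; simp
  have h2 : star u ⬝ᵥ ((x • (1 : Matrix (Fin d) (Fin d) ℂ) + ∑ i, z i •
      Matrix.vecMulVec (fun k => (v i k : ℂ)) (fun k => (v i k : ℂ))).mulVec u) =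
      x * ((∑ k, Complex.normSq (u k) : ℝ) : ℂ) +
        ∑ i, z i * ((Complex.normSq (∑ k, (v i k : ℂ) * u k) : ℝ) : ℂ) := by
    rw [Matrix.add_mulVec, dotProduct_add, Matrix.smul_mulVec, Matrix.one_mulVec,
      dotProduct_smul, smul_eq_mul, Matrix.sum_mulVec, dotProduct_sum]
    congr 1
    · congr 1
      push_cast
      refine Finset.sum_congr rfl fun k _ => ?_
      rw [Complex.normSq_eq_conj_mul_self]; rfl
    · refine Finset.sum_congr rfl fun i _ => ?_
      rw [Matrix.smul_mulVec, dotProduct_smul, smul_eq_mul, Complex.normSq_eq_conj_mul_self,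
        Matrix.vecMulVec_mulVec, map_sum]
      congr 1
      simp only [dotProduct, Pi.smul_apply, Pi.star_apply, MulOpposite.smul_eq_mul_unop,
        MulOpposite.unop_op, Finset.sum_mul]
      refine Finset.sum_congr rfl fun k _ => ?_
      rw [map_mul, Complex.conj_ofReal, starRingEnd_apply]
      ring
  rw [h2] at h1
  have h3 := congrArg Complex.im h1
  rw [Complex.add_im, Complex.im_mul_ofReal, Complex.im_sum] at h3
  simp only [Complex.im_mul_ofReal, Complex.zero_im] at h3
  have h4 : 0 < ∑ k, Complex.normSq (u k) := by
    obtain ⟨k, hk⟩ := Function.ne_iff.mp hu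
    exact Finset.sum_pos' (fun _ _ => Complex.normSq_nonneg _)
      ⟨k, Finset.mem_univ _, Complex.normSq_pos.mpr hk⟩
  have h5 : 0 ≤ ∑ i, (z i).im * Complex.normSq (∑ k, (v i k : ℂ) * u k) :=
    Finset.sum_nonneg fun i _ => mul_nonneg (hz i) (Complex.normSq_nonneg _)
  have := mul_pos hx h4
  linarith

lemma aux_eval {m d : ℕ} (μ : Finset (Fin m) → ℝ) (v : Fin m → Fin d → ℝ) (x : ℂ) :
    (Polynomial.aeval x) (mixedCharPoly μ v) = ∑ S : Finset (Fin m), (μ S : ℂ) *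
      (x ^ 2 • (1 : Matrix (Fin d) (Fin d) ℂ) - ∑ i ∈ S, (2 : ℂ) •
        Matrix.vecMulVec (fun k => (v i k : ℂ)) (fun k => (v i k : ℂ))).det := by
  unfold mixedCharPoly
  rw [map_sum]
  refine Finset.sum_congr rfl fun S _ => ?_
  rw [map_mul, Polynomial.aeval_C, AlgHom.map_det]
  congr 2
  ext a b
  simp only [AlgHom.mapMatrix_apply, Matrix.map_apply, Matrix.sub_apply, Matrix.smul_apply,
    Matrix.sum_apply, Matrix.vecMulVec_apply, map_sub, smul_eq_mul, map_mul, map_pow,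
    Polynomial.aeval_X, Polynomial.aeval_C, Matrix.one_apply]
  congr 1
  · split_ifs <;> simp
  · simp

lemma aux_upper {m d : ℕ} (μ : Finset (Fin m) → ℝ) (v : Fin m → Fin d → ℝ)
    (hnn : ∀ S, 0 ≤ μ S)
    (hhom : ∃ c : ℕ, ∀ S, 0 < μ S → S.card = c)
    (hSR : RealStable (genPoly μ)) (x : ℂ) (hx : 0 < x.im) :
    (Polynomial.aeval x) (mixedCharPoly μ v) ≠ 0 := by
  obtain ⟨c, hc⟩ := hhom
  have hx0 : x ≠ 0 := by rintro rfl; simp at hx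
  obtain ⟨G, hG⟩ := aux_expand (fun i k => (v i k : ℂ))
  have key := aux_pair (Finset.univ : Finset (Fin m))
    (fun T => x⁻¹ ^ T.card * ∑ S : Finset (Fin m), if T ⊆ S then (μ S : ℂ) else 0)
    (fun T => (2 * x⁻¹) ^ T.card * G T) ?_ ?_
  · rw [aux_eval]
    have e : ∀ S : Finset (Fin m), (x ^ 2 • (1 : Matrix (Fin d) (Fin d) ℂ) - ∑ i ∈ S, (2 : ℂ) •
        Matrix.vecMulVec (fun k => (v i k : ℂ)) (fun k => (v i k : ℂ))).det =
        (x ^ 2) ^ d * ∑ T : Finset (Fin m), if T ⊆ S then G T * (-(2 * x⁻¹ ^ 2)) ^ T.card else 0 := by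
      intro S
      have h1 : x ^ 2 • (1 : Matrix (Fin d) (Fin d) ℂ) - ∑ i ∈ S, (2 : ℂ) •
          Matrix.vecMulVec (fun k => (v i k : ℂ)) (fun k => (v i k : ℂ)) =
          x ^ 2 • (1 + ∑ i, (if i ∈ S then (-(2 * x⁻¹ ^ 2)) else 0) •
            Matrix.vecMulVec (fun k => (v i k : ℂ)) (fun k => (v i k : ℂ))) := by
        simp only [ite_smul, zero_smul]
        rw [Finset.sum_ite_mem, Finset.univ_inter, smul_add, sub_eq_add_neg,
          ← Finset.sum_neg_distrib, Finset.smul_sum]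
        congr 1
        refine Finset.sum_congr rfl fun i _ => ?_
        rw [smul_smul, ← neg_smul]
        congr 1
        field_simp
      rw [h1, Matrix.det_smul, hG, Fintype.card_fin]
      congr 1
      refine Finset.sum_congr rfl fun T _ => ?_
      split_ifs with hTS
      · rw [Finset.prod_congr rfl (fun i hi => if_pos (hTS hi)), Finset.prod_const]
      · obtain ⟨i, hi, hiS⟩ := Finset.not_subset.mp hTS
        rw [Finset.prod_eq_zero hi (if_neg hiS), mul_zero]
    simp only [e]
    have : ∑ S : Finset (Fin m), (μ S : ℂ) * ((x ^ 2) ^ d * ∑ T : Finset (Fin m),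
        if T ⊆ S then G T * (-(2 * x⁻¹ ^ 2)) ^ T.card else 0) =
        (x ^ 2) ^ d * ∑ T ∈ (Finset.univ : Finset (Fin m)).powerset, (-1) ^ T.card *
        ((x⁻¹ ^ T.card * ∑ S : Finset (Fin m), if T ⊆ S then (μ S : ℂ) else 0) *
        ((2 * x⁻¹) ^ T.card * G T)) := by
      rw [Finset.powerset_univ]
      simp only [Finset.mul_sum, Finset.sum_mul]
      rw [Finset.sum_comm]
      refine Finset.sum_congr rfl fun T _ => Finset.sum_congr rfl fun S _ => ?_
      split_ifs
      · rw [show (-(2 * x⁻¹ ^ 2)) = (-1) * x⁻¹ * (2 * x⁻¹) by ring, mul_pow, mul_pow]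
        ring
      · simp
    rw [this]
    exact mul_ne_zero (pow_ne_zero _ (pow_ne_zero _ hx0)) key
  · intro z hz
    have h1 := hSR (fun i => x + z i) (fun i => by
      rw [Complex.add_im]; have := hz i; linarith)
    have h2 : (MvPolynomial.aeval fun i => x + z i) (genPoly μ) =
        x ^ c * ∑ T ∈ (Finset.univ : Finset (Fin m)).powerset,
          (x⁻¹ ^ T.card * ∑ S : Finset (Fin m), if T ⊆ S then (μ S : ℂ) else 0) *
            ∏ i ∈ T, z i := by
      unfold genPoly
      rw [map_sum, Finset.powerset_univ]
      simp only [Finset.mul_sum, Finset.sum_mul]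
      rw [Finset.sum_comm]
      refine Finset.sum_congr rfl fun S _ => ?_
      rw [map_mul, MvPolynomial.aeval_C, map_prod]
      simp only [MvPolynomial.aeval_X]
      show (μ S : ℂ) * _ = _
      rcases (hnn S).eq_or_lt with h0 | h0
      · simp [← h0]
      · have h3 : ∏ i ∈ S, (x + z i) = x ^ c * ∏ i ∈ S, (1 + x⁻¹ * z i) := by
          rw [← hc S h0, ← Finset.prod_const, ← Finset.prod_mul_distrib]
          refine Finset.prod_congr rfl fun i _ => ?_
          field_simp
        rw [h3, Finset.prod_one_add]
        have h4 : S.powerset = Finset.univ.filter (fun T => T ⊆ S) := by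
          ext T; simp
        rw [h4, Finset.sum_filter, Finset.mul_sum, Finset.mul_sum]
        refine Finset.sum_congr rfl fun T _ => ?_
        split_ifs
        · rw [Finset.prod_mul_distrib, Finset.prod_const]; ring
        · simp
    rw [h2] at h1
    exact right_ne_zero_of_mul h1
  · intro z hz
    have h1 := aux_det v x hx (fun i => 2 * z i) (fun i => by
      have := hz i
      simp [Complex.mul_im]; linarith)
    have h2 : x • (1 : Matrix (Fin d) (Fin d) ℂ) + ∑ i, (2 * z i) • Matrix.vecMulVec
        (fun k => (v i k : ℂ)) (fun k => (v i k : ℂ)) =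
        x • (1 + ∑ i, (2 * x⁻¹ * z i) • Matrix.vecMulVec
        (fun k => (v i k : ℂ)) (fun k => (v i k : ℂ))) := by
      rw [smul_add, Finset.smul_sum]
      congr 1
      refine Finset.sum_congr rfl fun i _ => ?_
      rw [smul_smul]
      congr 1
      field_simp
    rw [h2, Matrix.det_smul, hG] at h1
    have h3 := right_ne_zero_of_mul h1
    convert h3 using 1
    rw [Finset.powerset_univ]
    refine Finset.sum_congr rfl fun T _ => ?_
    rw [Finset.prod_mul_distrib, Finset.prod_const]; ring

/-- For a homogeneous strongly Rayleigh probability distribution `μ`, the mixed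
characteristic polynomial is real-rooted: every complex root of it is real. -/
theorem stmt12 {m d : ℕ} (μ : Finset (Fin m) → ℝ) (v : Fin m → Fin d → ℝ)
    (hnn : ∀ S, 0 ≤ μ S)
    (hsum : ∑ S : Finset (Fin m), μ S = 1)
    (hhom : ∃ c : ℕ, ∀ S, 0 < μ S → S.card = c)
    (hSR : RealStable (genPoly μ)) :
    ∀ z : ℂ, (Polynomial.aeval z) (mixedCharPoly μ v) = 0 → z.im = 0 := by
  intro z hz
  rcases lt_trichotomy z.im 0 with h | h | h
  · exfalso
    refine aux_upper μ v hnn hhom hSR (-z) (by simpa using h) ?_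
    rw [aux_eval] at hz ⊢
    rw [neg_sq]
    exact hz
  · exact h
  · exact absurd hz (aux_upper μ v hnn hhom hSR z h)
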